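/- The Verlinde matrices N_λ are symmetric for all λ ∈ {0,...,9} except λ = 7 and λ = 8, and N_7 and N_8 are transposes of each other: N_7ᵗ = N_8. -/

import Mathlib

open Matrix Complex

noncomputable section

/-- d = 1 + √3 -/
def dd : ℂ := 1 + Real.sqrt 3

/-- L = 2 + d² = 6 + 2√3 -/
def LL : ℂ := 6 + 2 * Real.sqrt 3

/-- The S-matrix of the modular data of the quantum double of the even E6 system. -/
def S : Matrix (Fin 10) (Fin 10) ℂ := LL⁻¹ •
  !![1,    1,    1+dd, 1+dd, 2+dd,  dd,   dd,    dd,          dd,          dd;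
     1,    1,    1+dd, 1+dd, -2-dd, dd,   dd,    -dd,         -dd,         -dd;
     1+dd, 1+dd, 1,    1,    2+dd,  -dd,  -dd,   -dd,         -dd,         -dd;
     1+dd, 1+dd, 1,    1,    -2-dd, -dd,  -dd,   dd,          dd,          dd;
     2+dd, -2-dd,2+dd, -2-dd,0,     0,    0,     0,           0,           0;
     dd,   dd,   -dd,  -dd,  0,     dd,   dd,    -dd,         -dd,         2*dd;
     dd,   dd,   -dd,  -dd,  0,     dd,   dd,    -dd,         -dd,         -2*dd;
     dd,   -dd,  -dd,  dd,   0,     -dd,  dd,    -(2+dd)*I,   (2+dd)*I,    0;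
     dd,   -dd,  -dd,  dd,   0,     -dd,  dd,    (2+dd)*I,    -(2+dd)*I,   0;
     dd,   -dd,  -dd,  dd,   0,     2*dd, -2*dd, 0,           0,           0]

/-- The Verlinde matrices `(N_λ)_{μν} = Σ_σ S_{λσ} S_{μσ} conj(S_{νσ}) / S_{0σ}`. -/
def Nv (l : Fin 10) : Matrix (Fin 10) (Fin 10) ℂ := Matrix.of fun μ ν =>
  ∑ σ : Fin 10, S l σ * S μ σ * (starRingEnd ℂ) (S ν σ) / S 0 σ

lemma conj_dd : (starRingEnd ℂ) dd = dd := by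
  simp [dd, Complex.conj_ofReal]

lemma conj_LL : (starRingEnd ℂ) LL = LL := by
  simp [LL, Complex.conj_ofReal, Complex.conj_ofNat]

lemma swap_seven_eight (k : Fin 10) :
    Equiv.swap (7 : Fin 10) 8 k = ![0, 1, 2, 3, 4, 5, 6, 8, 7, 9] k := by
  revert k
  decide

/-- Complex conjugation of the S-matrix exchanges the columns 7 and 8. -/
lemma conj_S (i j : Fin 10) :
    (starRingEnd ℂ) (S i j) = S i (Equiv.swap 7 8 j) := by
  rw [swap_seven_eight]
  fin_cases j <;> fin_cases i <;> simp [S, conj_dd, conj_LL, Complex.conj_ofNat] <;> ring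

/-- The rows of the S-matrix other than 7 and 8 have equal entries in the columns 7 and 8. -/
lemma S_swap_of_ne {l : Fin 10} (h7 : l ≠ 7) (h8 : l ≠ 8) (j : Fin 10) :
    S l (Equiv.swap 7 8 j) = S l j := by
  rw [swap_seven_eight]
  fin_cases l <;> first | contradiction | (fin_cases j <;> simp [S])

lemma S_seven_swap (j : Fin 10) : S 7 (Equiv.swap 7 8 j) = S 8 j := by
  rw [swap_seven_eight]
  fin_cases j <;> simp [S]

/-- If row `m` of the S-matrix is row `l` with the columns 7 and 8 exchanged, then `N_lᵗ = N_m`. -/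
lemma transpose_Nv {l m : Fin 10} (hlm : ∀ j, S l (Equiv.swap 7 8 j) = S m j) :
    (Nv l)ᵀ = Nv m := by
  ext μ ν
  simp only [Nv, Matrix.transpose_apply, Matrix.of_apply]
  rw [← Equiv.sum_comp (Equiv.swap (7 : Fin 10) 8)]
  refine Finset.sum_congr rfl fun σ _ => ?_
  rw [hlm, S_swap_of_ne (l := 0) (by decide) (by decide), conj_S μ,
    ← Equiv.Perm.mul_apply, Equiv.swap_mul_self, Equiv.Perm.one_apply, conj_S ν]
  ring

/-- The Verlinde matrices N_λ are symmetric except for λ = 7, 8, and N_7ᵗ = N_8. -/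
theorem verlinde_symmetry :
    (∀ l : Fin 10, l ≠ 7 → l ≠ 8 → (Nv l)ᵀ = Nv l) ∧ (Nv 7)ᵀ = Nv 8 := by
  exact ⟨fun _ h7 h8 => transpose_Nv (S_swap_of_ne h7 h8), transpose_Nv S_seven_swap⟩
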